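/- arXiv:2405.18173 — 3 statements merged into one kernel-verified Lean document; each statement's English description precedes it below -/
import Mathlib

section
/- Let G=(V,E,ω,μ) be an infinite, locally finite, connected weighted graph with D_μ < ∞, let p>1, and let ψ:V→[0,∞) be bounded with ψ≢0. Then there exists Λ>0 such that for every λ>Λ the life span T_λ of the solution of u_t = Δu + u^p, u(·,0)=λψ is finite; moreover, lim_{λ→∞} λ^{p-1} T_λ = 1/((p-1)·‖ψ‖_{ℓ^∞(V)}^{p-1}). -/
open Filter Topology Set
open scoped ENNReal Classical

noncomputable section

/-- The graph Laplacian `Δu(x) = (1/μ(x)) ∑_y ω(x,y) (u(y) − u(x))`. -/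
def graphLap {V : Type*} (ω : V → V → ℝ) (μ : V → ℝ) (u : V → ℝ) (x : V) : ℝ :=
  (1 / μ x) * ∑' y, ω x y * (u y - u x)

/-- `(V, ω, μ)` is a locally finite connected weighted graph: `ω` is symmetric and
nonnegative (with `ω x y > 0` exactly for neighbours), there are no loops, every
vertex has finitely many neighbours, `μ > 0`, and the graph is connected. -/
structure IsWeightedGraph {V : Type*} (ω : V → V → ℝ) (μ : V → ℝ) : Prop where
  symm : ∀ x y, ω x y = ω y x
  nonneg : ∀ x y, 0 ≤ ω x y
  loopless : ∀ x, ω x x = 0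
  locallyFinite : ∀ x, {y | 0 < ω x y}.Finite
  measurePos : ∀ x, 0 < μ x
  connected : ∀ x y, Relation.ReflTransGen (fun a b => 0 < ω a b) x y

/-- `D_μ = sup_x m(x)/μ(x) < ∞`, where `m(x) = ∑_{y ∼ x} ω(x,y)`. -/
def DmuFinite {V : Type*} (ω : V → V → ℝ) (μ : V → ℝ) : Prop :=
  ∃ C : ℝ, ∀ x, (∑' y, ω x y) ≤ C * μ x

/-- A solution of `u_t = L u + u^p` on `V × [0,T)` with initial datum `ψ0`:
a nonnegative function, continuous in `t` on `[0,T)` for each fixed `x`,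
bounded on `V × [0,T']` for every `T' < T`, differentiable in `t` on `(0,T)`
and satisfying the equation pointwise there. -/
structure IsHeatSol {V : Type*} (L : (V → ℝ) → V → ℝ) (p : ℝ)
    (ψ0 : V → ℝ) (T : ℝ) (u : V → ℝ → ℝ) : Prop where
  nonneg : ∀ x, ∀ t ∈ Ico (0:ℝ) T, 0 ≤ u x t
  cont : ∀ x, ContinuousOn (u x) (Ico (0:ℝ) T)
  bounded : ∀ T' ∈ Ioo (0:ℝ) T, ∃ C : ℝ, ∀ x, ∀ t ∈ Icc (0:ℝ) T', |u x t| ≤ C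
  eqn : ∀ x, ∀ t ∈ Ioo (0:ℝ) T,
    HasDerivAt (u x) (L (fun y => u y t) x + u x t ^ p) t
  init : ∀ x, u x 0 = ψ0 x

/-- The life span `T_λ`: the supremum (in `ℝ≥0∞`) of all `T > 0` such that the
problem has a solution on `[0,T)`. -/
def lifeSpan {V : Type*} (L : (V → ℝ) → V → ℝ) (p : ℝ) (ψ0 : V → ℝ) : ℝ≥0∞ :=
  ⨆ (T : ℝ) (_ : 0 < T ∧ ∃ u, IsHeatSol L p ψ0 T u), ENNReal.ofReal T

/-- A nonnegative supersolution of `v' = v ^ (k + 1) - D v` starting above the equilibrium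
cannot exist beyond time `1 / (k (v(0) ^ k - D))`. -/
lemma blowup_time_le {v v' : ℝ → ℝ} {T D k : ℝ} (hk : 0 < k) (hD : 0 < D)
    (hcont : ContinuousOn v (Ico 0 T)) (hd : ∀ t ∈ Ioo 0 T, HasDerivAt v (v' t) t)
    (hineq : ∀ t ∈ Ioo 0 T, v t ^ (k + 1) - D * v t ≤ v' t)
    (hnn : ∀ t ∈ Ico 0 T, 0 ≤ v t) (h0 : 0 < v 0) (hDa : D < v 0 ^ k) :
    T ≤ 1 / (k * (v 0 ^ k - D)) := by
  refine le_of_forall_lt fun t htT => ?_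
  have hpos : 0 < k * (v 0 ^ k - D) := mul_pos hk (sub_pos.2 hDa)
  rcases le_or_gt t 0 with ht | ht
  · exact ht.trans_lt (by positivity)
  have hT : 0 < T := ht.trans htT
  set V : ℝ → ℝ := fun s => Real.exp (D * s) * v s with hV
  have hVd : ∀ s ∈ Ioo 0 T, HasDerivAt V (Real.exp (D * s) * (D * v s + v' s)) s := by
    intro s hs
    have h1 : HasDerivAt (fun s => Real.exp (D * s)) (Real.exp (D * s) * D) s := by
      simpa using ((hasDerivAt_id s).const_mul D).exp
    exact (h1.mul (hd s hs)).congr_deriv (by ring)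
  have hVc : ContinuousOn V (Ico 0 T) :=
    ContinuousOn.mul (by fun_prop) hcont
  have hVm : MonotoneOn V (Ico 0 T) := by
    refine monotoneOn_of_deriv_nonneg (convex_Ico 0 T) hVc ?_ ?_
    · rw [interior_Ico]
      exact fun s hs => (hVd s hs).differentiableAt.differentiableWithinAt
    · rw [interior_Ico]
      intro s hs
      rw [(hVd s hs).deriv]
      have h1 := hineq s hs
      have h2 : 0 ≤ v s ^ (k + 1) := Real.rpow_nonneg (hnn s (Ioo_subset_Ico_self hs)) _
      exact mul_nonneg (Real.exp_pos _).le (by linarith)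
  have hV0 : V 0 = v 0 := by simp [hV]
  have hVpos : ∀ s ∈ Ico 0 T, 0 < V s := fun s hs =>
    (hV0 ▸ h0 : 0 < V 0).trans_le (hVm ⟨le_rfl, hT⟩ hs hs.1)
  set W : ℝ → ℝ := fun s => V s ^ (-k) + (1 - Real.exp (-(k * D) * s)) / D with hW
  have hWd : ∀ s ∈ Ioo 0 T, HasDerivAt W
      (Real.exp (D * s) * (D * v s + v' s) * (-k) * V s ^ (-k - 1)
        + k * Real.exp (-(k * D) * s)) s := by
    intro s hs
    have h1 : HasDerivAt (fun s => Real.exp (-(k * D) * s))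
        (Real.exp (-(k * D) * s) * (-(k * D))) s := by
      simpa using ((hasDerivAt_id s).const_mul (-(k * D))).exp
    have h2 := (hVd s hs).rpow_const (p := -k) (Or.inl (hVpos s (Ioo_subset_Ico_self hs)).ne')
    refine (h2.add ((h1.const_sub 1).div_const D)).congr_deriv ?_
    field_simp
  have hWc : ContinuousOn W (Ico 0 T) := by
    refine ContinuousOn.add ?_ (by fun_prop)
    exact hVc.rpow_const fun s hs => Or.inl (hVpos s hs).ne'
  have hWa : AntitoneOn W (Ico 0 T) := by
    refine antitoneOn_of_deriv_nonpos (convex_Ico 0 T) hWc ?_ ?_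
    · rw [interior_Ico]
      exact fun s hs => (hWd s hs).differentiableAt.differentiableWithinAt
    · rw [interior_Ico]
      intro s hs
      rw [(hWd s hs).deriv]
      have hs' := Ioo_subset_Ico_self hs
      have hVs := hVpos s hs'
      have h1 : v s ^ (k + 1) ≤ D * v s + v' s := by linarith [hineq s hs]
      have h2 : v s = Real.exp (-(D * s)) * V s := by
        simp only [hV]
        rw [← mul_assoc, ← Real.exp_add]
        simp
      have h3 : Real.exp (D * s) * v s ^ (k + 1) * V s ^ (-k - 1)
          = Real.exp (-(k * D) * s) := by
        rw [h2, Real.mul_rpow (Real.exp_pos _).le hVs.le, ← Real.exp_mul]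
        have h4 : V s ^ (k + 1) * V s ^ (-k - 1) = 1 := by
          rw [← Real.rpow_add hVs]
          simp
        calc _ = Real.exp (D * s) * Real.exp (-(D * s) * (k + 1))
                * (V s ^ (k + 1) * V s ^ (-k - 1)) := by ring
          _ = _ := by rw [h4, mul_one, ← Real.exp_add]; congr 1; ring
      have h5 : Real.exp (D * s) * v s ^ (k + 1) * V s ^ (-k - 1)
          ≤ Real.exp (D * s) * (D * v s + v' s) * V s ^ (-k - 1) := by
        have := (Real.rpow_pos_of_pos hVs (-k - 1)).le
        gcongr
      rw [h3] at h5
      nlinarith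
  have hle := hWa ⟨le_rfl, hT⟩ ⟨ht.le, htT⟩ ht.le
  have hW0 : W 0 = (v 0 ^ k)⁻¹ := by
    simp [hW, hV0, Real.rpow_neg h0.le]
  have hWt : (1 - Real.exp (-(k * D) * t)) / D < W t :=
    lt_add_of_pos_left _ (Real.rpow_pos_of_pos (hVpos t ⟨ht.le, htT⟩) _)
  have ha : 0 < v 0 ^ k := Real.rpow_pos_of_pos h0 _
  have hs : 0 < k * D * t := by positivity
  have hexp : Real.exp (-(k * D) * t) ≤ 1 / (1 + k * D * t) := by
    rw [neg_mul, Real.exp_neg, ← one_div]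
    exact one_div_le_one_div_of_le (by linarith) (by linarith [Real.add_one_le_exp (k * D * t)])
  have h1 : (1 - 1 / (1 + k * D * t)) / D < (v 0 ^ k)⁻¹ := by
    refine lt_of_le_of_lt ?_ ((hWt.trans_le hle).trans_eq hW0)
    gcongr
  have h2 : (1 - 1 / (1 + k * D * t)) / D = k * t / (1 + k * D * t) := by
    field_simp
    ring
  rw [h2, inv_eq_one_div, div_lt_div_iff₀ (by linarith) ha] at h1
  rw [lt_div_iff₀ hpos]
  linarith

section MonotoneIteration

variable {V : Type*} (S : V → Finset V) (a : V → V → ℝ) (D p : ℝ) (φ : V → ℝ)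

/-- The source term, after the substitution `v(t) = exp (D t) u(t)`, of the equation
`u_t = ∑ a(x,y) u(y) - D u + u ^ p`. -/
def expSource (x : V) (s : ℝ) (v : V → ℝ) : ℝ :=
  ∑ y ∈ S x, a x y * v y + Real.exp (D * s) * (Real.exp (-(D * s)) * v x) ^ p

/-- Picard iterates started at zero for `v_t = expSource x t v`, `v(0) = φ`. -/
def picardIter : ℕ → V → ℝ → ℝ
  | 0, _, _ => 0
  | n + 1, x, t => φ x + ∫ s in (0 : ℝ)..t, expSource S a D p x s fun y => picardIter n y s

variable {S a D p φ}

lemma expSource_mono (ha : ∀ x y, 0 ≤ a x y) (hp : 0 ≤ p) {x : V} {s : ℝ} {v w : V → ℝ}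
    (hv : ∀ y, 0 ≤ v y) (hvw : ∀ y, v y ≤ w y) :
    expSource S a D p x s v ≤ expSource S a D p x s w := by
  have h1 : ∀ y, 0 ≤ a x y := ha x
  have h2 : 0 ≤ Real.exp (-(D * s)) * v x := mul_nonneg (Real.exp_pos _).le (hv x)
  unfold expSource
  gcongr with y _
  · exact h1 y
  · exact hvw y
  · exact hvw x

lemma expSource_nonneg (ha : ∀ x y, 0 ≤ a x y) {x : V} {s : ℝ} {v : V → ℝ}
    (hv : ∀ y, 0 ≤ v y) : 0 ≤ expSource S a D p x s v :=
  add_nonneg (Finset.sum_nonneg fun y _ => mul_nonneg (ha x y) (hv y))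
    (mul_nonneg (Real.exp_pos _).le
      (Real.rpow_nonneg (mul_nonneg (Real.exp_pos _).le (hv x)) _))

lemma continuousOn_expSource (hp : 0 ≤ p) {x : V} {v : V → ℝ → ℝ} {I : Set ℝ}
    (hv : ∀ y, ContinuousOn (v y) I) :
    ContinuousOn (fun s => expSource S a D p x s fun y => v y s) I := by
  unfold expSource
  refine ContinuousOn.add ?_ (ContinuousOn.mul (by fun_prop) ?_)
  · exact continuousOn_finsetSum _ fun y _ => continuousOn_const.mul (hv y)
  · exact ContinuousOn.rpow_const (ContinuousOn.mul (by fun_prop) (hv x)) fun _ _ => Or.inr hp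

lemma tendsto_expSource (hp : 0 ≤ p) {x : V} {s : ℝ} {v : ℕ → V → ℝ} {w : V → ℝ}
    (hv : ∀ y, Tendsto (fun n => v n y) atTop (𝓝 (w y))) :
    Tendsto (fun n => expSource S a D p x s (v n)) atTop (𝓝 (expSource S a D p x s w)) := by
  unfold expSource
  refine Tendsto.add (tendsto_finsetSum _ fun y _ => (hv y).const_mul _) ?_
  exact (((hv x).const_mul _).rpow_const (Or.inr hp)).const_mul _

lemma continuous_picardIter (hp : 0 ≤ p) (n : ℕ) (x : V) :
    Continuous (picardIter S a D p φ n x) := by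
  induction n generalizing x with
  | zero => exact continuous_const
  | succ n ih =>
    have h : Continuous fun s => expSource S a D p x s fun y => picardIter S a D p φ n y s := by
      rw [← continuousOn_univ]
      exact continuousOn_expSource hp fun y => (ih y).continuousOn
    exact continuous_const.add
      (intervalIntegral.continuous_primitive (fun _ _ => h.intervalIntegrable _ _) 0)

lemma continuous_expSource_picardIter (hp : 0 ≤ p) (n : ℕ) (x : V) :
    Continuous fun s => expSource S a D p x s fun y => picardIter S a D p φ n y s := by
  rw [← continuousOn_univ]
  exact continuousOn_expSource hp fun y => (continuous_picardIter hp n y).continuousOn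

lemma picardIter_nonneg (ha : ∀ x y, 0 ≤ a x y) (hφ : ∀ x, 0 ≤ φ x) (n : ℕ) (x : V) {t : ℝ}
    (ht : 0 ≤ t) : 0 ≤ picardIter S a D p φ n x t := by
  induction n generalizing x t with
  | zero => exact le_rfl
  | succ n ih =>
    exact add_nonneg (hφ x) (intervalIntegral.integral_nonneg ht fun s hs =>
      expSource_nonneg ha fun y => ih y hs.1)

lemma picardIter_le_succ (ha : ∀ x y, 0 ≤ a x y) (hp : 0 ≤ p) (hφ : ∀ x, 0 ≤ φ x) (n : ℕ)
    (x : V) {t : ℝ} (ht : 0 ≤ t) :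
    picardIter S a D p φ n x t ≤ picardIter S a D p φ (n + 1) x t := by
  induction n generalizing x t with
  | zero => exact picardIter_nonneg ha hφ 1 x ht
  | succ n ih =>
    refine add_le_add le_rfl (intervalIntegral.integral_mono_on ht
      ((continuous_expSource_picardIter hp _ x).intervalIntegrable _ _)
      ((continuous_expSource_picardIter hp _ x).intervalIntegrable _ _) fun s hs => ?_)
    exact expSource_mono ha hp (fun y => picardIter_nonneg ha hφ n y hs.1) fun y => ih y hs.1

section Supersolution

variable {T : ℝ} {N : ℝ → ℝ}

lemma intervalIntegrable_expSource_const (hp : 0 ≤ p) (hNc : ContinuousOn N (Ico 0 T)) (x : V)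
    {t : ℝ} (ht : t ∈ Ico 0 T) : IntervalIntegrable
      (fun s => expSource S a D p x s fun _ => N s) MeasureTheory.volume 0 t := by
  refine ContinuousOn.intervalIntegrable ?_
  rw [uIcc_of_le ht.1]
  exact (continuousOn_expSource hp fun _ => hNc).mono fun s hs => ⟨hs.1, hs.2.trans_lt ht.2⟩

/-- A spatially constant supersolution dominates every Picard iterate. -/
lemma picardIter_le (ha : ∀ x y, 0 ≤ a x y) (hp : 0 ≤ p) (hφ : ∀ x, 0 ≤ φ x)
    (hN0 : ∀ x, φ x ≤ N 0) (hNnn : ∀ t ∈ Ico 0 T, 0 ≤ N t)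
    (hN : ∀ x, ∀ t ∈ Ico 0 T, HasDerivAt N (expSource S a D p x t fun _ => N t) t)
    (n : ℕ) (x : V) {t : ℝ} (ht : t ∈ Ico 0 T) :
    picardIter S a D p φ n x t ≤ N t := by
  have hNc : ContinuousOn N (Ico 0 T) := fun t ht => (hN x t ht).continuousAt.continuousWithinAt
  induction n generalizing x t with
  | zero => exact hNnn t ht
  | succ n ih =>
    have hsub : ∀ s ∈ Icc 0 t, s ∈ Ico 0 T := fun s hs => ⟨hs.1, hs.2.trans_lt ht.2⟩
    have key := intervalIntegrable_expSource_const (S := S) (a := a) (D := D) hp hNc x ht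
    have hint : (∫ s in (0 : ℝ)..t, expSource S a D p x s fun _ => N s) = N t - N 0 := by
      refine intervalIntegral.integral_eq_sub_of_hasDerivAt (fun s hs => ?_) key
      rw [uIcc_of_le ht.1] at hs
      exact hN x s (hsub s hs)
    have hle : (∫ s in (0 : ℝ)..t, expSource S a D p x s fun y => picardIter S a D p φ n y s)
        ≤ ∫ s in (0 : ℝ)..t, expSource S a D p x s fun _ => N s := by
      refine intervalIntegral.integral_mono_on ht.1
        ((continuous_expSource_picardIter hp _ x).intervalIntegrable _ _) key fun s hs => ?_
      exact expSource_mono ha hp (fun y => picardIter_nonneg ha hφ n y hs.1)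
        fun y => ih y (hsub s hs)
    have hx := hN0 x
    change φ x + _ ≤ _
    linarith

/-- The Picard iterates converge to a solution as long as a spatially constant supersolution
exists. -/
lemma exists_isHeatSol_of_supersolution {L : (V → ℝ) → V → ℝ}
    (hL : ∀ u x, L u x = ∑ y ∈ S x, a x y * u y - D * u x)
    (ha : ∀ x y, 0 ≤ a x y) (hp : 0 ≤ p) (hφ : ∀ x, 0 ≤ φ x)
    (hN0 : ∀ x, φ x ≤ N 0) (hNnn : ∀ t ∈ Ico 0 T, 0 ≤ N t) (hT : 0 < T)
    (hNc : ContinuousOn N (Ico 0 T))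
    (hN : ∀ x, ∀ t ∈ Ico 0 T, HasDerivAt N (expSource S a D p x t fun _ => N t) t) :
    ∃ u, IsHeatSol L p φ T u := by
  set v : V → ℝ → ℝ := fun x t => ⨆ n, picardIter S a D p φ n x t with hv
  have hlim : ∀ x, ∀ t ∈ Ico 0 T,
      Tendsto (fun n => picardIter S a D p φ n x t) atTop (𝓝 (v x t)) := fun x t ht =>
    tendsto_atTop_ciSup (monotone_nat_of_le_succ fun n => picardIter_le_succ ha hp hφ n x ht.1)
      ⟨N t, by rintro _ ⟨n, rfl⟩; exact picardIter_le ha hp hφ hN0 hNnn hN n x ht⟩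
  have hv0 : ∀ x, ∀ t ∈ Ico 0 T, 0 ≤ v x t := fun x t ht =>
    ge_of_tendsto' (hlim x t ht) fun n => picardIter_nonneg ha hφ n x ht.1
  have hvN : ∀ x, ∀ t ∈ Ico 0 T, v x t ≤ N t := fun x t ht =>
    le_of_tendsto' (hlim x t ht) fun n => picardIter_le ha hp hφ hN0 hNnn hN n x ht
  have hmem : ∀ {t}, t ∈ Ico 0 T → ∀ s ∈ uIoc 0 t, s ∈ Ico 0 T := by
    intro t ht s hs
    rw [uIoc_of_le ht.1] at hs
    exact ⟨hs.1.le, hs.2.trans_lt ht.2⟩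
  have hbound : ∀ x, ∀ s ∈ Ico 0 T, ∀ w : V → ℝ, (∀ y, 0 ≤ w y) → (∀ y, w y ≤ N s) →
      ‖expSource S a D p x s w‖ ≤ expSource S a D p x s fun _ => N s := by
    intro x s hs w hw hwN
    rw [Real.norm_of_nonneg (expSource_nonneg ha hw)]
    exact expSource_mono ha hp hw hwN
  have hmeas : ∀ x, ∀ t ∈ Ico 0 T, IntervalIntegrable
      (fun s => expSource S a D p x s fun y => v y s) MeasureTheory.volume 0 t := by
    intro x t ht
    refine (intervalIntegrable_expSource_const (S := S) (a := a) (D := D) hp hNc x ht).mono_fun'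
      ?_ ?_
    · refine aestronglyMeasurable_of_tendsto_ae (u := atTop)
        (f := fun n s => expSource S a D p x s fun y => picardIter S a D p φ n y s)
        (fun n => (continuous_expSource_picardIter hp n x).aestronglyMeasurable) ?_
      refine (MeasureTheory.ae_restrict_iff' measurableSet_uIoc).2 (.of_forall fun s hs => ?_)
      exact tendsto_expSource hp fun y => hlim y s (hmem ht s hs)
    · refine (MeasureTheory.ae_restrict_iff' measurableSet_uIoc).2 (.of_forall fun s hs => ?_)
      have hs' := hmem ht s hs
      exact hbound x s hs' _ (fun y => hv0 y s hs') fun y => hvN y s hs'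
  have heq : ∀ x, ∀ t ∈ Ico 0 T,
      v x t = φ x + ∫ s in (0 : ℝ)..t, expSource S a D p x s fun y => v y s := by
    intro x t ht
    refine tendsto_nhds_unique ((hlim x t ht).comp (tendsto_add_atTop_nat 1)) ?_
    refine Tendsto.const_add (φ x) ?_
    refine intervalIntegral.tendsto_integral_filter_of_dominated_convergence
      (fun s => expSource S a D p x s fun _ => N s) ?_ ?_
      (intervalIntegrable_expSource_const hp hNc x ht) ?_
    · exact .of_forall fun n => (continuous_expSource_picardIter hp n x).aestronglyMeasurable
    · refine .of_forall fun n => .of_forall fun s hs => ?_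
      have hs' := hmem ht s hs
      exact hbound x s hs' _ (fun y => picardIter_nonneg ha hφ n y hs'.1)
        fun y => picardIter_le ha hp hφ hN0 hNnn hN n y hs'
    · exact .of_forall fun s hs => tendsto_expSource hp fun y => hlim y s (hmem ht s hs)
  have hvc : ∀ x, ContinuousOn (v x) (Ico 0 T) := by
    intro x t ht
    obtain ⟨r, hr, hrT⟩ := exists_between ht.2
    have hr' : r ∈ Ico 0 T := ⟨ht.1.trans hr.le, hrT⟩
    have h1 : ContinuousOn
        (fun t => φ x + ∫ s in (0 : ℝ)..t, expSource S a D p x s fun y => v y s) (Icc 0 r) := by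
      refine continuousOn_const.add ?_
      have := intervalIntegral.continuousOn_primitive_interval' (hmeas x r hr') left_mem_uIcc
      rwa [uIcc_of_le hr'.1] at this
    have h2 : ContinuousOn (v x) (Icc 0 r) :=
      h1.congr fun s hs => heq x s ⟨hs.1, hs.2.trans_lt hrT⟩
    refine (h2 t ⟨ht.1, hr.le⟩).mono_of_mem_nhdsWithin ?_
    filter_upwards [self_mem_nhdsWithin, mem_nhdsWithin_of_mem_nhds (Iio_mem_nhds hr)]
      with s hs hsr using ⟨hs.1, le_of_lt hsr⟩
  have hvd : ∀ x, ∀ t ∈ Ioo 0 T,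
      HasDerivAt (v x) (expSource S a D p x t fun y => v y t) t := by
    intro x t ht
    have hc : ContinuousOn (fun s => expSource S a D p x s fun y => v y s) (Ioo 0 T) :=
      continuousOn_expSource hp fun y => (hvc y).mono Ioo_subset_Ico_self
    have h1 := (intervalIntegral.integral_hasDerivAt_right (hmeas x t (Ioo_subset_Ico_self ht))
      (hc.stronglyMeasurableAtFilter isOpen_Ioo t ht)
      (hc.continuousAt (Ioo_mem_nhds ht.1 ht.2))).const_add (φ x)
    refine h1.congr_of_eventuallyEq ?_
    filter_upwards [Ioo_mem_nhds ht.1 ht.2] with s hs using heq x s (Ioo_subset_Ico_self hs)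
  have hexp : ContinuousOn (fun t => Real.exp (-(D * t))) (Ico 0 T) := by fun_prop
  refine ⟨fun x t => Real.exp (-(D * t)) * v x t, ?_, ?_, ?_, ?_, ?_⟩
  · exact fun x t ht => mul_nonneg (Real.exp_pos _).le (hv0 x t ht)
  · exact fun x => hexp.mul (hvc x)
  · intro r hr
    have hsub : Icc 0 r ⊆ Ico 0 T := fun s hs => ⟨hs.1, hs.2.trans_lt hr.2⟩
    obtain ⟨C, hC⟩ := isCompact_Icc.exists_bound_of_continuousOn ((hexp.mul hNc).mono hsub)
    refine ⟨C, fun x t ht => ?_⟩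
    have ht' := hsub ht
    refine le_trans ?_ ((le_abs_self _).trans (hC t ht))
    rw [abs_of_nonneg (mul_nonneg (Real.exp_pos _).le (hv0 x t ht'))]
    exact mul_le_mul_of_nonneg_left (hvN x t ht') (Real.exp_pos _).le
  · intro x t ht
    have h1 : HasDerivAt (fun s => Real.exp (-(D * s))) (Real.exp (-(D * t)) * (-D)) t := by
      simpa using ((hasDerivAt_id t).const_mul D).neg.exp
    refine (h1.mul (hvd x t ht)).congr_deriv ?_
    have h2 : Real.exp (-(D * t)) * Real.exp (D * t) = 1 := by
      rw [← Real.exp_add]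
      simp
    have h3 : ∑ y ∈ S x, a x y * (Real.exp (-(D * t)) * v y t)
        = Real.exp (-(D * t)) * ∑ y ∈ S x, a x y * v y t := by
      rw [Finset.mul_sum]
      exact Finset.sum_congr rfl fun y _ => by ring
    rw [hL, h3]
    unfold expSource
    linear_combination ((Real.exp (-(D * t)) * v x t) ^ p) * h2
  · intro x
    simp [heq x 0 ⟨le_rfl, hT⟩]

end Supersolution

/-- Up to the blow-up time of `M' = M ^ (k + 1)`, `M(0) = m`, a solution exists for all data
bounded by `m`. -/
lemma exists_isHeatSol {L : (V → ℝ) → V → ℝ}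
    (hL : ∀ u x, L u x = ∑ y ∈ S x, a x y * u y - D * u x)
    (ha : ∀ x y, 0 ≤ a x y) (haD : ∀ x, ∑ y ∈ S x, a x y = D) {k m : ℝ} (hk : 0 < k)
    (hm : 0 < m) (hφ : ∀ x, 0 ≤ φ x) (hφm : ∀ x, φ x ≤ m) :
    ∃ u, IsHeatSol L (k + 1) φ (1 / (k * m ^ k)) u := by
  have hmk : 0 < m ^ k := Real.rpow_pos_of_pos hm k
  have hT : (0 : ℝ) < 1 / (k * m ^ k) := by positivity
  set M : ℝ → ℝ := fun t => ((m ^ k)⁻¹ - k * t) ^ (-(1 / k)) with hM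
  have hb : ∀ t ∈ Ico 0 (1 / (k * m ^ k)), 0 < (m ^ k)⁻¹ - k * t := by
    intro t ht
    have h1 := ht.2
    rw [lt_div_iff₀ (by positivity)] at h1
    rw [sub_pos, inv_eq_one_div, lt_div_iff₀ hmk]
    linarith
  have hMpos : ∀ t ∈ Ico 0 (1 / (k * m ^ k)), 0 < M t := fun t ht =>
    Real.rpow_pos_of_pos (hb t ht) _
  have hMd : ∀ t ∈ Ico 0 (1 / (k * m ^ k)), HasDerivAt M (M t ^ (k + 1)) t := by
    intro t ht
    have h1 : HasDerivAt (fun t => (m ^ k)⁻¹ - k * t) (-k) t := by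
      simpa using ((hasDerivAt_id t).const_mul k).const_sub ((m ^ k)⁻¹)
    refine (h1.rpow_const (p := -(1 / k)) (Or.inl (hb t ht).ne')).congr_deriv ?_
    rw [hM, ← Real.rpow_mul (hb t ht).le]
    have h2 : -(1 / k) * (k + 1) = -(1 / k) - 1 := by
      field_simp
      ring
    rw [h2]
    field_simp
  have hM0 : M 0 = m := by
    simp only [hM, mul_zero, sub_zero]
    rw [← Real.rpow_neg hm.le, ← Real.rpow_mul hm.le]
    have : -k * -(1 / k) = 1 := by field_simp
    rw [this, Real.rpow_one]
  have hNd : ∀ x, ∀ t ∈ Ico 0 (1 / (k * m ^ k)), HasDerivAt (fun t => Real.exp (D * t) * M t)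
      (expSource S a D (k + 1) x t fun _ => Real.exp (D * t) * M t) t := by
    intro x t ht
    have h1 : HasDerivAt (fun s => Real.exp (D * s)) (Real.exp (D * t) * D) t := by
      simpa using ((hasDerivAt_id t).const_mul D).exp
    refine (h1.mul (hMd t ht)).congr_deriv ?_
    have h2 : Real.exp (-(D * t)) * (Real.exp (D * t) * M t) = M t := by
      rw [← mul_assoc, ← Real.exp_add]
      simp
    simp only [expSource]
    rw [← Finset.sum_mul, haD, h2]
    ring
  refine exists_isHeatSol_of_supersolution (N := fun t => Real.exp (D * t) * M t) hL ha
    (by linarith) hφ ?_ ?_ hT ?_ hNd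
  · simpa [hM0] using hφm
  · exact fun t ht => mul_nonneg (Real.exp_pos _).le (hMpos t ht).le
  · exact ContinuousOn.mul (by fun_prop)
      fun t ht => (hMd t ht).continuousAt.continuousWithinAt

end MonotoneIteration

/-- With bounded weighted degree, the Laplacian is a nonnegative finite-range operator minus a
multiple of the identity. -/
lemma exists_graphLap_eq {V : Type*} {ω : V → V → ℝ} {μ : V → ℝ} (hG : IsWeightedGraph ω μ)
    (hD : DmuFinite ω μ) : ∃ (S : V → Finset V) (a : V → V → ℝ) (D : ℝ), 0 < D ∧
      (∀ x y, 0 ≤ a x y) ∧ (∀ x, ∑ y ∈ S x, a x y = D) ∧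
      ∀ u x, graphLap ω μ u x = ∑ y ∈ S x, a x y * u y - D * u x := by
  obtain ⟨C, hC⟩ := hD
  set S : V → Finset V := fun x => insert x (hG.locallyFinite x).toFinset with hS
  have hzero : ∀ x, ∀ y ∉ S x, ω x y = 0 := by
    intro x y hy
    simp only [hS, Finset.mem_insert, Finite.mem_toFinset, mem_ofPred_eq, not_or, not_lt] at hy
    exact le_antisymm hy.2 (hG.nonneg x y)
  have hdeg : ∀ x, ∑' y, ω x y = ∑ y ∈ S x, ω x y := fun x => tsum_eq_sum (hzero x)
  set D := max C 1
  have hdeg_le : ∀ x, (∑ y ∈ S x, ω x y) / μ x ≤ D := fun x => by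
    rw [div_le_iff₀ (hG.measurePos x), ← hdeg]
    exact (hC x).trans (mul_le_mul_of_nonneg_right (le_max_left _ _) (hG.measurePos x).le)
  have hsum : ∀ x (u : V → ℝ), ∑ y ∈ S x, (ω x y / μ x
      + if y = x then D - (∑ z ∈ S x, ω x z) / μ x else 0) * u y
      = (∑ y ∈ S x, ω x y * u y) / μ x + (D - (∑ z ∈ S x, ω x z) / μ x) * u x := by
    intro x u
    have hx : x ∈ S x := Finset.mem_insert_self _ _
    simp only [add_mul, ite_mul, zero_mul, Finset.sum_add_distrib, Finset.sum_ite_eq', hx, if_true,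
      Finset.sum_div]
    congr 1
    exact Finset.sum_congr rfl fun y _ => by ring
  refine ⟨S, fun x y => ω x y / μ x + if y = x then D - (∑ z ∈ S x, ω x z) / μ x else 0, D,
    lt_max_of_lt_right one_pos, fun x y => ?_, fun x => ?_, fun u x => ?_⟩
  · refine add_nonneg (div_nonneg (hG.nonneg x y) (hG.measurePos x).le) ?_
    split_ifs
    · exact sub_nonneg.2 (hdeg_le x)
    · exact le_rfl
  · have := hsum x fun _ => 1
    simp only [mul_one] at this
    rw [this]
    ring
  · rw [hsum, graphLap, tsum_eq_sum (s := S x) fun y hy => by rw [hzero x y hy, zero_mul]]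
    simp only [mul_sub, Finset.sum_sub_distrib, ← Finset.sum_mul]
    ring

/-- Upper bound on the life span from the value of the initial datum at one vertex. -/
lemma lifeSpan_le {V : Type*} {S : V → Finset V} {a : V → V → ℝ} {D k : ℝ}
    {L : (V → ℝ) → V → ℝ} (hL : ∀ u x, L u x = ∑ y ∈ S x, a x y * u y - D * u x)
    (ha : ∀ x y, 0 ≤ a x y) (hD : 0 < D) (hk : 0 < k) {φ : V → ℝ} {x : V} (h0 : 0 < φ x)
    (hx : D < φ x ^ k) :
    lifeSpan L (k + 1) φ ≤ ENNReal.ofReal (1 / (k * (φ x ^ k - D))) := by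
  refine iSup₂_le fun T ⟨hT, u, hu⟩ => ENNReal.ofReal_le_ofReal ?_
  rw [← hu.init x] at h0 hx ⊢
  refine blowup_time_le hk hD (hu.cont x) (hu.eqn x) (fun t ht => ?_) (hu.nonneg x) h0 hx
  have h1 : 0 ≤ ∑ y ∈ S x, a x y * u y t := Finset.sum_nonneg fun y _ =>
    mul_nonneg (ha x y) (hu.nonneg y t (Ioo_subset_Ico_self ht))
  rw [hL]
  linarith

/-- Lower bound on the life span from the supremum of the initial datum. -/
lemma le_lifeSpan {V : Type*} {S : V → Finset V} {a : V → V → ℝ} {D k m : ℝ}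
    {L : (V → ℝ) → V → ℝ} (hL : ∀ u x, L u x = ∑ y ∈ S x, a x y * u y - D * u x)
    (ha : ∀ x y, 0 ≤ a x y) (haD : ∀ x, ∑ y ∈ S x, a x y = D) (hk : 0 < k) (hm : 0 < m)
    {φ : V → ℝ} (hφ : ∀ x, 0 ≤ φ x) (hφm : ∀ x, φ x ≤ m) :
    ENNReal.ofReal (1 / (k * m ^ k)) ≤ lifeSpan L (k + 1) φ :=
  le_iSup₂_of_le (1 / (k * m ^ k))
    ⟨by have := Real.rpow_pos_of_pos hm k; positivity,
      exists_isHeatSol hL ha haD hk hm hφ hφm⟩ le_rfl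

/-- Theorem 1.3: on an infinite locally finite connected weighted graph with
`D_μ < ∞`, the life span `T_λ` of the solution of `u_t = Δu + u^p`,
`u(·,0) = λψ` is finite for all large `λ`, and
`lim_{λ→∞} λ^{p-1} T_λ = 1/((p-1) ‖ψ‖_{ℓ^∞}^{p-1})`. -/
theorem stmt0 {V : Type*} [Infinite V] [Countable V]
    (ω : V → V → ℝ) (μ : V → ℝ) (hG : IsWeightedGraph ω μ) (hD : DmuFinite ω μ)
    (p : ℝ) (hp : 1 < p)
    (ψ : V → ℝ) (hψ0 : ∀ x, 0 ≤ ψ x) (hψbd : ∃ C : ℝ, ∀ x, ψ x ≤ C)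
    (hψne : ∃ x, ψ x ≠ 0) :
    ∃ Λ : ℝ, 0 < Λ ∧
      (∀ lam : ℝ, Λ < lam →
        lifeSpan (graphLap ω μ) p (fun x => lam * ψ x) < ⊤) ∧
      Tendsto
        (fun lam : ℝ => ENNReal.ofReal (lam ^ (p - 1)) *
          lifeSpan (graphLap ω μ) p (fun x => lam * ψ x))
        atTop
        (𝓝 (ENNReal.ofReal (1 / ((p - 1) * (⨆ x, ψ x) ^ (p - 1))))) := by
  obtain ⟨S, a, D, hDpos, ha, haD, hL⟩ := exists_graphLap_eq hG hD
  obtain ⟨k, rfl⟩ : ∃ k, p = k + 1 := ⟨p - 1, by ring⟩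
  have hk : 0 < k := by linarith
  simp only [add_sub_cancel_right]
  obtain ⟨x₀, hx₀⟩ := hψne
  have hx₀ : 0 < ψ x₀ := lt_of_le_of_ne (hψ0 x₀) hx₀.symm
  have hbdd : BddAbove (range ψ) := by
    obtain ⟨C, hC⟩ := hψbd
    exact ⟨C, by rintro _ ⟨x, rfl⟩; exact hC x⟩
  set Ψ := ⨆ x, ψ x
  have hΨ : 0 < Ψ := hx₀.trans_le (le_ciSup hbdd x₀)
  have hlarge : ∀ x, 0 < ψ x → ∀ᶠ lam : ℝ in atTop, D < (lam * ψ x) ^ k := fun x hx =>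
    ((tendsto_rpow_atTop hk).comp (tendsto_id.atTop_mul_const hx)).eventually_gt_atTop D
  obtain ⟨Λ, hΛ⟩ := eventually_atTop.1 (hlarge x₀ hx₀)
  refine ⟨max Λ 1, lt_max_of_lt_right one_pos, fun lam hlam => ?_, ?_⟩
  · have hlam0 : 0 < lam := one_pos.trans ((le_max_right _ _).trans_lt hlam)
    exact (lifeSpan_le hL ha hDpos hk (mul_pos hlam0 hx₀)
      (hΛ lam ((le_max_left _ _).trans hlam.le))).trans_lt ENNReal.ofReal_lt_top
  refine tendsto_order.2 ⟨fun b hb => ?_, fun b hb => ?_⟩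
  · filter_upwards [eventually_gt_atTop 0] with lam hlam
    refine hb.trans_le ?_
    have hlk : 0 < lam ^ k := Real.rpow_pos_of_pos hlam k
    have hΨk : 0 < Ψ ^ k := Real.rpow_pos_of_pos hΨ k
    have h1 := le_lifeSpan hL ha haD hk (mul_pos hlam hΨ)
      (fun x => mul_nonneg hlam.le (hψ0 x))
      (fun x => mul_le_mul_of_nonneg_left (le_ciSup hbdd x) hlam.le)
    refine le_trans (le_of_eq ?_) (mul_le_mul_right h1 _)
    rw [← ENNReal.ofReal_mul hlk.le, Real.mul_rpow hlam.le hΨ.le]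
    congr 1
    field_simp
  · have hcont : ContinuousAt (fun r : ℝ => ENNReal.ofReal (1 / (k * r ^ k))) Ψ := by
      refine ENNReal.continuous_ofReal.continuousAt.comp ?_
      refine continuousAt_const.div (continuousAt_const.mul
        (continuousAt_id.rpow_const (Or.inl hΨ.ne'))) ?_
      exact (mul_pos hk (Real.rpow_pos_of_pos hΨ k)).ne'
    obtain ⟨x, hx, hxb⟩ : ∃ x, 0 < ψ x ∧ ENNReal.ofReal (1 / (k * ψ x ^ k)) < b := by
      obtain ⟨l, hl, hlb⟩ := exists_Ioc_subset_of_mem_nhds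
        (hcont.eventually_lt continuousAt_const hb) ⟨0, hΨ⟩
      have : Nonempty V := ⟨x₀⟩
      obtain ⟨x, hx⟩ := exists_lt_of_lt_ciSup (max_lt hl hΨ)
      exact ⟨x, (le_max_right _ _).trans_lt hx,
        hlb ⟨(le_max_left _ _).trans_lt hx, le_ciSup hbdd x⟩⟩
    have hψk : 0 < ψ x ^ k := Real.rpow_pos_of_pos hx k
    have hlim : Tendsto (fun lam : ℝ => ENNReal.ofReal (1 / (k * (ψ x ^ k - D / lam ^ k))))
        atTop (𝓝 (ENNReal.ofReal (1 / (k * ψ x ^ k)))) := by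
      refine ENNReal.tendsto_ofReal (tendsto_const_nhds.div ?_ (mul_pos hk hψk).ne')
      refine Tendsto.const_mul k ?_
      simpa using ((tendsto_rpow_atTop hk).const_div_atTop D).const_sub (ψ x ^ k)
    filter_upwards [hlim.eventually_lt_const hxb, hlarge x hx, eventually_gt_atTop 0]
      with lam h1 h2 hlam
    have hlk : 0 < lam ^ k := Real.rpow_pos_of_pos hlam k
    refine lt_of_le_of_lt (mul_le_mul_right (lifeSpan_le hL ha hDpos hk (mul_pos hlam hx) h2) _)
      (lt_of_eq_of_lt ?_ h1)
    rw [Real.mul_rpow hlam.le hx.le] at h2 ⊢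
    rw [← ENNReal.ofReal_mul hlk.le]
    have h3 : ψ x ^ k - D / lam ^ k = (lam ^ k * ψ x ^ k - D) / lam ^ k := by
      field_simp
    rw [h3]
    congr 1
    have h4 : lam ^ k * ψ x ^ k - D ≠ 0 := (sub_pos.2 h2).ne'
    field_simp
end
end

section
/- Let G=(V,E,ω,μ) be an infinite, locally finite, connected weighted graph with D_μ<∞, D_ω<∞, ω_min = inf_{e∈E} ω_e > 0 and inf_{x∈V} μ(x) > 0, satisfying the curvature condition CDE'(n,0) for some n>0 and the volume growth condition: there exist positive constants c₀, m, r₀ with 𝒱(x,r) ≤ c₀ r^m for all x∈V and r ≥ r₀. Let p>1 and let ψ:V→[0,∞) be bounded with ψ≢0. If there exists x̄∈V such that liminf_{d(x̄,x)→∞} ψ(x) > 0, then the life span T_λ of the solution of u_t = Δu + u^p, u(·,0)=λψ is finite for every λ>0. -/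
open Filter Topology Set
open scoped ENNReal Classical

noncomputable section

/-- There is a path with `n` edges from `x` to `y`. -/
def ReachesIn {V : Type*} (ω : V → V → ℝ) (n : ℕ) (x y : V) : Prop :=
  ∃ f : ℕ → V, f 0 = x ∧ f n = y ∧ ∀ i < n, 0 < ω (f i) (f (i + 1))

/-- The graph distance: the least number of edges of a path joining `x` and `y`. -/
def graphDist {V : Type*} (ω : V → V → ℝ) (x y : V) : ℕ :=
  sInf {n : ℕ | ReachesIn ω n x y}

/-- The gradient form `Γ(f,g)(x) = (1/(2μ(x))) ∑_y ω(x,y)(f(y)−f(x))(g(y)−g(x))`. -/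
def gradForm {V : Type*} (ω : V → V → ℝ) (μ : V → ℝ) (f g : V → ℝ) (x : V) : ℝ :=
  (1 / (2 * μ x)) * ∑' y, ω x y * (f y - f x) * (g y - g x)

/-- The iterated gradient form `Γ₂(f) = ½(Δ Γ(f) − 2 Γ(f, Δf))`. -/
def gradForm2 {V : Type*} (ω : V → V → ℝ) (μ : V → ℝ) (f : V → ℝ) (x : V) : ℝ :=
  (1 / 2) * (graphLap ω μ (fun y => gradForm ω μ f f y) x
    - 2 * gradForm ω μ f (graphLap ω μ f) x)

/-- The exponential curvature dimension condition `CDE'(n, K)`. -/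
def CDEPrime {V : Type*} (ω : V → V → ℝ) (μ : V → ℝ) (n K : ℝ) : Prop :=
  ∀ f : V → ℝ, (∀ x, 0 < f x) → ∀ x,
    (1 / n) * (f x * graphLap ω μ (fun y => Real.log (f y)) x) ^ 2
        + K * gradForm ω μ f f x ≤
      gradForm2 ω μ f x - gradForm ω μ f (fun y => gradForm ω μ f f y / f y) x

/-- The ball `B_x^r = {y : d(x,y) ≤ r}`. -/
def gBall {V : Type*} (ω : V → V → ℝ) (x : V) (r : ℝ) : Set V :=
  {y | (graphDist ω x y : ℝ) ≤ r}

/-- The volume `𝒱(x,r) = ∑_{y ∈ B_x^r} μ(y)`. -/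
def gVol {V : Type*} (ω : V → V → ℝ) (μ : V → ℝ) (x : V) (r : ℝ) : ℝ :=
  ∑' y : gBall ω x r, μ (y : V)

lemma ReachesIn.refl {V : Type*} (ω : V → V → ℝ) (x : V) : ReachesIn ω 0 x x :=
  ⟨fun _ => x, rfl, rfl, fun i hi => absurd hi (Nat.not_lt_zero i)⟩

lemma ReachesIn.trans {V : Type*} {ω : V → V → ℝ} {m n : ℕ} {x y z : V}
    (h₁ : ReachesIn ω m x y) (h₂ : ReachesIn ω n y z) : ReachesIn ω (m + n) x z := by
  obtain ⟨f, hf0, hfm, hf⟩ := h₁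
  obtain ⟨g, hg0, hgn, hg⟩ := h₂
  refine ⟨fun i => if i ≤ m then f i else g (i - m), by simp [hf0], ?_, fun i hi => ?_⟩
  · rcases Nat.eq_zero_or_pos n with rfl | hn
    · simp [hfm, ← hgn, hg0]
    · simp [hn.ne', hgn]
  · rcases lt_trichotomy i m with h | rfl | h
    · simpa [h.le, Nat.succ_le_of_lt h] using hf i h
    · simpa [hfm, hg0] using hg 0 (by omega)
    · have h' : i + 1 - m = i - m + 1 := by omega
      simpa [h.not_ge, show ¬ i + 1 ≤ m by omega, h'] using hg (i - m) (by omega)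

lemma ReachesIn.symm {V : Type*} {ω : V → V → ℝ} (hω : ∀ x y, ω x y = ω y x) {n : ℕ} {x y : V}
    (h : ReachesIn ω n x y) : ReachesIn ω n y x := by
  obtain ⟨f, hf0, hfn, hf⟩ := h
  refine ⟨fun i => f (n - i), by simpa, by simpa, fun i hi => ?_⟩
  have h' : n - i = n - (i + 1) + 1 := by omega
  rw [hω]
  simpa only [h'] using hf (n - (i + 1)) (by omega)

lemma ReachesIn.of_edge {V : Type*} {ω : V → V → ℝ} {x y : V} (h : 0 < ω x y) :
    ReachesIn ω 1 x y := by
  refine ⟨fun i => if i = 0 then x else y, by simp, by simp, fun i hi => ?_⟩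
  obtain rfl : i = 0 := by omega
  simpa using h

lemma IsWeightedGraph.exists_reachesIn {V : Type*} {ω : V → V → ℝ} {μ : V → ℝ}
    (hG : IsWeightedGraph ω μ) (x y : V) : ∃ n, ReachesIn ω n x y := by
  induction hG.connected x y with
  | refl => exact ⟨0, .refl ω x⟩
  | tail _ hbc ih => exact ih.imp' (· + 1) fun n hn => hn.trans (.of_edge hbc)

lemma IsWeightedGraph.reachesIn_graphDist {V : Type*} {ω : V → V → ℝ} {μ : V → ℝ}
    (hG : IsWeightedGraph ω μ) (x y : V) : ReachesIn ω (graphDist ω x y) x y :=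
  Nat.sInf_mem (hG.exists_reachesIn x y)

lemma ReachesIn.graphDist_le {V : Type*} {ω : V → V → ℝ} {n : ℕ} {x y : V}
    (h : ReachesIn ω n x y) : graphDist ω x y ≤ n :=
  Nat.sInf_le h

lemma IsWeightedGraph.graphDist_triangle {V : Type*} {ω : V → V → ℝ} {μ : V → ℝ}
    (hG : IsWeightedGraph ω μ) (x y z : V) :
    graphDist ω x z ≤ graphDist ω x y + graphDist ω y z :=
  ((hG.reachesIn_graphDist x y).trans (hG.reachesIn_graphDist y z)).graphDist_le

lemma IsWeightedGraph.graphDist_comm {V : Type*} {ω : V → V → ℝ} {μ : V → ℝ}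
    (hG : IsWeightedGraph ω μ) (x y : V) : graphDist ω x y = graphDist ω y x :=
  le_antisymm ((hG.reachesIn_graphDist y x).symm hG.symm).graphDist_le
    ((hG.reachesIn_graphDist x y).symm hG.symm).graphDist_le

lemma IsWeightedGraph.finite_reachesIn {V : Type*} {ω : V → V → ℝ} {μ : V → ℝ}
    (hG : IsWeightedGraph ω μ) (x : V) (n : ℕ) : {y | ReachesIn ω n x y}.Finite := by
  induction n with
  | zero =>
    refine (finite_singleton x).subset ?_
    rintro y ⟨f, rfl, rfl, -⟩
    rfl
  | succ n ih =>
    refine (ih.biUnion fun z _ => hG.locallyFinite z).subset ?_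
    rintro y ⟨f, hf0, rfl, hf⟩
    exact mem_biUnion (x := f n) ⟨f, hf0, rfl, fun i hi => hf i (by omega)⟩ (hf n (by omega))

lemma IsWeightedGraph.finite_closedBall {V : Type*} {ω : V → V → ℝ} {μ : V → ℝ}
    (hG : IsWeightedGraph ω μ) (x : V) (n : ℕ) : {y | graphDist ω x y ≤ n}.Finite := by
  refine ((finite_le_nat n).biUnion fun k _ => hG.finite_reachesIn x k).subset fun y hy => ?_
  exact mem_biUnion (x := graphDist ω x y) hy (hG.reachesIn_graphDist x y)

/-- If `f` drops by at most `h` along each edge at `x`, then `Δf(x) ≥ -h D_μ`. -/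
lemma IsWeightedGraph.neg_mul_le_graphLap {V : Type*} {ω : V → V → ℝ} {μ : V → ℝ}
    (hG : IsWeightedGraph ω μ) {D : ℝ} (hD : ∀ x, (∑' y, ω x y) ≤ D * μ x) {h : ℝ} (hh : 0 ≤ h)
    {f : V → ℝ} {x : V} (hf : ∀ y, 0 < ω x y → -h ≤ f y - f x) :
    -(h * D) ≤ graphLap ω μ f x := by
  have hsupp : ∀ F : V → ℝ, Summable fun y => ω x y * F y := fun F =>
    summable_of_hasFiniteSupport <| (hG.locallyFinite x).subset fun y hy =>
      (hG.nonneg x y).lt_of_ne' (left_ne_zero_of_mul hy)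
  have hle : ∑' y, ω x y * -h ≤ ∑' y, ω x y * (f y - f x) :=
    (hsupp fun _ => -h).tsum_le_tsum (fun y => by
      rcases (hG.nonneg x y).eq_or_lt with h0 | h0
      · simp [← h0]
      · exact mul_le_mul_of_nonneg_left (hf y h0) h0.le) (hsupp _)
  rw [tsum_mul_right] at hle
  have hμ := hG.measurePos x
  rw [graphLap, one_div, inv_mul_eq_div, le_div_iff₀ hμ]
  nlinarith [mul_le_mul_of_nonneg_left (hD x) hh]

lemma HasDerivAt.nonpos_of_forall_lt_ge {v : ℝ → ℝ} {v' t : ℝ} (hv : HasDerivAt v v' t)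
    (ht : 0 < t) (h : ∀ s ∈ Ioo 0 t, v t ≤ v s) : v' ≤ 0 := by
  refine le_of_tendsto (hasDerivWithinAt_iff_tendsto_slope' (s := Iio t) (by simp) |>.1
    hv.hasDerivWithinAt) ?_
  filter_upwards [Ioo_mem_nhdsLT ht] with s hs
  rw [slope_def_field]
  exact div_nonpos_of_nonneg_of_nonpos (sub_nonneg.2 (h s hs)) (sub_nonpos.2 hs.2.le)

/-- A finite family of continuous functions, positive at time `0`, stays positive if whenever a
member vanishes while all others are nonnegative, it has positive time derivative. -/
lemma pos_of_deriv_pos_at_zero {V : Type*} {S : Set V} (hS : S.Finite) {v : V → ℝ → ℝ} {T : ℝ}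
    (hcont : ∀ x ∈ S, ContinuousOn (v x) (Icc 0 T)) (hinit : ∀ x ∈ S, 0 < v x 0)
    (htouch : ∀ t ∈ Ioc 0 T, ∀ x ∈ S, v x t = 0 → (∀ y ∈ S, 0 ≤ v y t) →
      ∃ v', HasDerivAt (v x) v' t ∧ 0 < v') :
    ∀ x ∈ S, ∀ t ∈ Icc 0 T, 0 < v x t := by
  by_contra! hcon
  obtain ⟨x₁, hx₁, t₁, ht₁, hv₁⟩ := hcon
  set K : Set ℝ := ⋃ x ∈ S, Icc 0 T ∩ v x ⁻¹' Iic 0 with hK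
  have hKclosed : IsClosed K := hS.isClosed_biUnion fun x hx =>
    (hcont x hx).preimage_isClosed_of_isClosed isClosed_Icc isClosed_Iic
  have hKbdd : BddBelow K := ⟨0, fun t ht => by
    obtain ⟨x, -, ht, -⟩ := mem_iUnion₂.1 ht
    exact ht.1⟩
  have hmem := hKclosed.csInf_mem ⟨t₁, mem_biUnion hx₁ ⟨ht₁, hv₁⟩⟩ hKbdd
  set t := sInf K
  obtain ⟨x, hx, ht, hvx⟩ := mem_iUnion₂.1 hmem
  have hpos : ∀ y ∈ S, ∀ s ∈ Ico 0 t, 0 < v y s := fun y hy s hs => by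
    by_contra! hle
    exact hs.2.not_ge (csInf_le hKbdd (mem_biUnion hy ⟨⟨hs.1, hs.2.le.trans ht.2⟩, hle⟩))
  have ht0 : 0 < t := ht.1.lt_of_ne fun h => (hinit x hx).not_ge (h ▸ hvx)
  have hnn : ∀ y ∈ S, 0 ≤ v y t := fun y hy => by
    have htend : Tendsto (v y) (𝓝[<] t) (𝓝 (v y t)) :=
      (hcont y hy t ht).mono_left <| le_inf inf_le_left <| le_principal_iff.2 <|
        mem_of_superset (Ioo_mem_nhdsLT ht0) fun s hs => ⟨hs.1.le, hs.2.le.trans ht.2⟩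
    refine ge_of_tendsto htend ?_
    filter_upwards [Ioo_mem_nhdsLT ht0] with s hs using (hpos y hy s ⟨hs.1.le, hs.2⟩).le
  obtain ⟨v', hv', hv'pos⟩ := htouch t ⟨ht0, ht.2⟩ x hx (le_antisymm hvx (hnn x hx)) hnn
  exact hv'pos.not_ge <| hv'.nonpos_of_forall_lt_ge ht0 fun s hs =>
    hvx.trans (hpos x hx s ⟨hs.1.le, hs.2⟩).le

lemma rpow_sub_mul_le_sub_rpow {p g e : ℝ} (hp : 1 ≤ p) (hg : 0 < g) (he : e ≤ g) :
    g ^ p - p * g ^ (p - 1) * e ≤ (g - e) ^ p := by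
  have h1 := one_add_mul_self_le_rpow_one_add (s := -(e / g))
    (neg_le_neg ((div_le_one hg).2 he)) hp
  have h2 : g - e = g * (1 + -(e / g)) := by field_simp; ring
  rw [h2, Real.mul_rpow hg.le (by linarith [(div_le_one hg).2 he])]
  refine le_trans (le_of_eq ?_) (mul_le_mul_of_nonneg_left h1 (Real.rpow_nonneg hg.le p))
  rw [Real.rpow_sub_one hg.ne']
  field_simp
  ring

/-- Comparison with the subsolution `g(t) - η e^{Kt} d(x₀,x)` on a ball around `x₀`. -/
lemma IsHeatSol.lt_of_subsolution {V : Type*} {ω : V → V → ℝ} {μ : V → ℝ}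
    (hG : IsWeightedGraph ω μ) {D : ℝ} (hD : ∀ x, (∑' y, ω x y) ≤ D * μ x)
    {p : ℝ} (hp : 1 ≤ p) {ψ : V → ℝ} {T : ℝ} {u : V → ℝ → ℝ}
    (hu : IsHeatSol (graphLap ω μ) p ψ T u) {T₁ : ℝ} (hT₁ : 0 ≤ T₁) (hT₁T : T₁ < T)
    {g : ℝ → ℝ} (hgd : ∀ t ∈ Icc 0 T₁, HasDerivAt g (g t ^ p / 2) t)
    (hgpos : ∀ t ∈ Icc 0 T₁, 0 < g t) {G : ℝ} (hgG : ∀ t ∈ Icc 0 T₁, g t ≤ G)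
    {η K : ℝ} (hη : 0 < η) (hK : 0 ≤ K) (hGK : p * G ^ (p - 1) ≤ K)
    (hηD : ∀ t ∈ Icc 0 T₁, η * Real.exp (K * t) * D < g t ^ p / 2)
    {N : ℕ} (hN : G < η * N) {x₀ : V}
    (hinit : ∀ x, graphDist ω x₀ x ≤ N → g 0 < ψ x) :
    g T₁ < u x₀ T₁ := by
  set d : V → ℝ := fun x => graphDist ω x₀ x
  have hd0 : d x₀ = 0 := by
    have := (ReachesIn.refl ω x₀).graphDist_le
    simp only [d, Nat.cast_eq_zero]
    omega
  have hdnn : ∀ x, 0 ≤ d x := fun x => Nat.cast_nonneg _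
  set v : V → ℝ → ℝ := fun x t => u x t - (g t - η * Real.exp (K * t) * d x) with hv
  have hmain : ∀ x ∈ {x | graphDist ω x₀ x ≤ N}, ∀ t ∈ Icc 0 T₁, 0 < v x t := by
    refine pos_of_deriv_pos_at_zero (hG.finite_closedBall x₀ N) (fun x _ => ?_) (fun x hx => ?_) ?_
    · refine ((hu.cont x).mono fun t ht => ⟨ht.1, ht.2.trans_lt hT₁T⟩).sub
        (ContinuousOn.sub (fun t ht => (hgd t ht).continuousAt.continuousWithinAt) ?_)
      fun_prop
    · have := hinit x hx
      have := mul_nonneg hη.le (hdnn x)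
      simp only [hv, hu.init, mul_zero, Real.exp_zero, mul_one]
      linarith
    · intro t ht x hx hvx hnn
      have htI : t ∈ Icc 0 T₁ := ⟨ht.1.le, ht.2⟩
      have htT : t < T := ht.2.trans_lt hT₁T
      set h := η * Real.exp (K * t) with hh
      have hηh : η ≤ h := le_mul_of_one_le_right hη.le (Real.one_le_exp (mul_nonneg hK ht.1.le))
      have hh0 : 0 < h := hη.trans_le hηh
      have hall : ∀ y, g t - h * d y ≤ u y t := fun y => by
        by_cases hy : graphDist ω x₀ y ≤ N
        · exact sub_nonneg.1 (hnn y hy)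
        · have hNy : (N : ℝ) ≤ d y := Nat.cast_le.2 (not_le.1 hy).le
          have h1 := hu.nonneg y t ⟨ht.1.le, htT⟩
          have h2 := mul_le_mul hηh hNy (Nat.cast_nonneg _) hh0.le
          linarith [hgG t htI]
      have hux : u x t = g t - h * d x := sub_eq_zero.1 hvx
      have hlap : -(h * D) ≤ graphLap ω μ (fun y => u y t) x :=
        hG.neg_mul_le_graphLap hD hh0.le fun y hxy => by
          have hdy : d y ≤ d x + 1 := by
            have h1 := hG.graphDist_triangle x₀ x y
            have h2 := (ReachesIn.of_edge hxy).graphDist_le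
            simp only [d]
            exact_mod_cast h1.trans (Nat.add_le_add_left h2 _)
          have := hall y
          have := mul_le_mul_of_nonneg_left hdy hh0.le
          linarith
      have hexp : HasDerivAt (fun s => η * Real.exp (K * s) * d x) (K * h * d x) t := by
        have := ((((hasDerivAt_id t).const_mul K).exp.const_mul η).mul_const (d x))
        refine this.congr_deriv ?_
        simp only [hh, id]
        ring
      refine ⟨_, (hu.eqn x t ⟨ht.1, htT⟩).sub ((hgd t htI).sub hexp), ?_⟩
      have hgt := hgpos t htI
      have hun := hu.nonneg x t ⟨ht.1.le, htT⟩
      have hbern := rpow_sub_mul_le_sub_rpow hp hgt (e := h * d x) (by linarith)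
      have hKg : p * g t ^ (p - 1) ≤ K := le_trans (mul_le_mul_of_nonneg_left
        (Real.rpow_le_rpow hgt.le (hgG t htI) (by linarith)) (by linarith)) hGK
      have hKgd := mul_le_mul_of_nonneg_right hKg (mul_nonneg hh0.le (hdnn x))
      have := hηD t htI
      rw [hux]
      linarith
  have hfin := hmain x₀ (by
    have := (ReachesIn.refl ω x₀).graphDist_le
    simp only [mem_ofPred_eq]
    omega) T₁ ⟨hT₁, le_rfl⟩
  simp only [hv, hd0, mul_zero, sub_zero] at hfin
  linarith

lemma hasDerivAt_rpow_blowup {p a t : ℝ} (hp : 1 < p) (hpos : 0 < a - (p - 1) / 2 * t) :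
    HasDerivAt (fun s => (a - (p - 1) / 2 * s) ^ (-(1 / (p - 1))))
      (((a - (p - 1) / 2 * t) ^ (-(1 / (p - 1)))) ^ p / 2) t := by
  have hp1 : p - 1 ≠ 0 := by linarith
  have h := ((((hasDerivAt_id t).const_mul ((p - 1) / 2)).const_sub a).rpow_const
    (p := -(1 / (p - 1))) (Or.inl hpos.ne'))
  refine h.congr_deriv ?_
  rw [← Real.rpow_mul hpos.le, show -(1 / (p - 1)) * p = -(1 / (p - 1)) - 1 by field_simp; ring]
  simp only [id]
  field_simp

/-- If the initial datum exceeds `κ` outside a finite ball, every solution lives at most until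
`2 κ^{-(p-1)} / (p-1)`. -/
lemma IsHeatSol.time_le {V : Type*} [Infinite V] {ω : V → V → ℝ} {μ : V → ℝ}
    (hG : IsWeightedGraph ω μ) (hDμ : DmuFinite ω μ) {p : ℝ} (hp : 1 < p) {ψ : V → ℝ}
    {κ : ℝ} (hκ : 0 < κ) {xb : V} {R : ℕ} (hψ : ∀ x, R ≤ graphDist ω xb x → κ < ψ x)
    {T : ℝ} {u : V → ℝ → ℝ} (hu : IsHeatSol (graphLap ω μ) p ψ T u) :
    T ≤ κ ^ (-(p - 1)) / ((p - 1) / 2) := by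
  by_contra! hT
  obtain ⟨D, hD⟩ := hDμ
  have hp1 : 0 < p - 1 := by linarith
  set b := (p - 1) / 2 with hb
  have hb0 : 0 < b := by positivity
  set a := κ ^ (-(p - 1)) with ha
  have ha0 : 0 < a := by positivity
  set q := 1 / (p - 1) with hq
  have hq0 : 0 < q := by positivity
  have hinv : ∀ z : ℝ, 0 < z → (z ^ (-(p - 1))) ^ (-q) = z := fun z hz => by
    rw [← Real.rpow_mul hz.le, hq, neg_mul_neg, mul_one_div_cancel hp1.ne', Real.rpow_one]
  obtain ⟨C, hC⟩ := hu.bounded (a / b) ⟨by positivity, hT⟩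
  set s := min a ((|C| + 1) ^ (-(p - 1))) with hs
  have hs0 : 0 < s := lt_min ha0 (by positivity)
  set T₁ := (a - s) / b with hT₁
  have hbT₁ : b * T₁ = a - s := by rw [hT₁]; field_simp
  have hT₁0 : 0 ≤ T₁ := div_nonneg (sub_nonneg.2 (min_le_left _ _)) hb0.le
  have hT₁a : T₁ ≤ a / b := div_le_div_of_nonneg_right (by linarith) hb0.le
  set g : ℝ → ℝ := fun t => (a - b * t) ^ (-q) with hg
  have hbase : ∀ t ∈ Icc 0 T₁, s ≤ a - b * t ∧ a - b * t ≤ a := fun t ht => by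
    have h1 := mul_le_mul_of_nonneg_left ht.2 hb0.le
    have h2 := mul_nonneg hb0.le ht.1
    constructor <;> linarith
  set G := s ^ (-q) with hGdef
  have hG0 : 0 < G := by positivity
  have hgG : ∀ t ∈ Icc 0 T₁, g t ≤ G := fun t ht =>
    Real.rpow_le_rpow_of_nonpos hs0 (hbase t ht).1 (by linarith)
  have hκg : ∀ t ∈ Icc 0 T₁, κ ≤ g t := fun t ht => by
    rw [← hinv κ hκ]
    exact Real.rpow_le_rpow_of_nonpos (hs0.trans_le (hbase t ht).1) (hbase t ht).2 (by linarith)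
  have hg0 : g 0 = κ := by simp only [hg, mul_zero, sub_zero, ha, hinv κ hκ]
  have hgT₁ : g T₁ = G := by simp only [hg, hbT₁, hGdef, sub_sub_cancel]
  have hCG : |C| + 1 ≤ G := by
    rw [← hinv (|C| + 1) (by positivity)]
    exact Real.rpow_le_rpow_of_nonpos hs0 (min_le_right _ _) (by linarith)
  set K := p * G ^ (p - 1) with hK
  have hK0 : 0 ≤ K := by positivity
  set η := κ ^ p / 4 / (Real.exp (K * T₁) * (|D| + 1)) with hη
  have hη0 : 0 < η := by positivity
  obtain ⟨N, hN⟩ := exists_nat_gt (G / η)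
  rw [div_lt_iff₀' hη0] at hN
  obtain ⟨x₀, hx₀⟩ := (hG.finite_closedBall xb (R + N)).exists_notMem
  simp only [mem_ofPred_eq, not_le] at hx₀
  have hlt := hu.lt_of_subsolution hG hD hp.le hT₁0 (hT₁a.trans_lt hT)
    (g := g) (G := G) (η := η) (K := K) (N := N) (x₀ := x₀)
    (fun t ht => hasDerivAt_rpow_blowup hp (hs0.trans_le (hbase t ht).1))
    (fun t ht => hκ.trans_le (hκg t ht)) hgG hη0 hK0 le_rfl ?_ hN ?_
  · have := hC x₀ T₁ ⟨hT₁0, hT₁a⟩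
    have := le_abs_self C
    have := le_abs_self (u x₀ T₁)
    linarith
  · intro t ht
    have hexp : Real.exp (K * t) ≤ Real.exp (K * T₁) :=
      Real.exp_le_exp.2 (mul_le_mul_of_nonneg_left ht.2 hK0)
    have hmul : Real.exp (K * t) * D ≤ Real.exp (K * T₁) * (|D| + 1) :=
      (mul_le_mul_of_nonneg_left ((le_abs_self D).trans (by linarith)) (Real.exp_pos _).le).trans
        (mul_le_mul_of_nonneg_right hexp (by positivity))
    have hηeq : η * (Real.exp (K * T₁) * (|D| + 1)) = κ ^ p / 4 := by
      rw [hη]; field_simp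
    have h1 := mul_le_mul_of_nonneg_left hmul hη0.le
    have h2 : κ ^ p ≤ g t ^ p := Real.rpow_le_rpow hκ.le (hκg t ht) (by linarith)
    have h3 : 0 < κ ^ p := by positivity
    linarith
  · intro x hx
    rw [hg0]
    apply hψ
    have h1 := hG.graphDist_triangle xb x x₀
    rw [hG.graphDist_comm x x₀] at h1
    omega

/-- Theorem 1.4: under `D_μ, D_ω < ∞`, `ω_min > 0`, `inf μ > 0`, `CDE'(n,0)` and
the polynomial volume growth condition (VG), if `liminf_{d(x̄,x)→∞} ψ(x) > 0`
then the life span is finite for every `λ > 0`. -/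
theorem stmt1 {V : Type*} [Infinite V] [Countable V]
    (ω : V → V → ℝ) (μ : V → ℝ) (hG : IsWeightedGraph ω μ) (hDμ : DmuFinite ω μ)
    -- `D_ω = μ_max / ω_min < ∞` and `ω_min > 0` and `inf μ > 0`:
    (hμmax : ∃ C : ℝ, ∀ x, μ x ≤ C)
    (hωmin : ∃ c : ℝ, 0 < c ∧ ∀ x y, 0 < ω x y → c ≤ ω x y)
    (hμmin : ∃ c : ℝ, 0 < c ∧ ∀ x, c ≤ μ x)
    (n : ℝ) (hn : 0 < n) (hCDE : CDEPrime ω μ n 0)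
    (hVG : ∃ c₀ > (0:ℝ), ∃ m > (0:ℝ), ∃ r₀ > (0:ℝ),
      ∀ x, ∀ r : ℝ, r₀ ≤ r → gVol ω μ x r ≤ c₀ * r ^ m)
    (p : ℝ) (hp : 1 < p)
    (ψ : V → ℝ) (hψ0 : ∀ x, 0 ≤ ψ x) (hψbd : ∃ C : ℝ, ∀ x, ψ x ≤ C)
    (hψne : ∃ x, ψ x ≠ 0)
    -- `liminf_{d(x̄,x)→∞} ψ(x) > 0`:
    (xb : V) (hliminf : ∃ c > (0:ℝ), ∃ R : ℕ, ∀ x, R ≤ graphDist ω xb x → c ≤ ψ x) :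
    ∀ lam : ℝ, 0 < lam → lifeSpan (graphLap ω μ) p (fun x => lam * ψ x) < ⊤ := by
  intro lam hlam
  obtain ⟨c, hc, R, hR⟩ := hliminf
  refine lt_of_le_of_lt (iSup₂_le fun T hT => ?_)
    (ENNReal.ofReal_lt_top (r := (lam * c / 2) ^ (-(p - 1)) / ((p - 1) / 2)))
  obtain ⟨-, u, hu⟩ := hT
  refine ENNReal.ofReal_le_ofReal (hu.time_le hG hDμ hp (by positivity) (xb := xb) (R := R) ?_)
  intro x hx
  have h1 := mul_le_mul_of_nonneg_left (hR x hx) hlam.le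
  have h2 := mul_pos hlam hc
  linarith
end
end

section
/- Let G=(V,E,ω,μ) be an infinite, locally finite, connected weighted graph with D_μ<∞, let p>1, and let ψ:V→[0,∞) be bounded with ψ≢0. Suppose there are a vertex x̃∈V and a constant ψ_∞>0 such that lim_{d(x̃,x)→∞} ψ(x) = ψ_∞, and G satisfies the eigenvalue condition (EC): for any ε>0 and δ>0 there exists a finite connected subset Ω⊂V with nonempty interior such that λ₁(Ω) < ε and d(x,x̃) > δ for all x∈Ω. Then for every λ>0, the life span satisfies T_λ ≤ 1/((p-1) λ^{p-1} ψ_∞^{p-1}). -/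
open Filter Topology Set
open scoped ENNReal Classical

noncomputable section

/-- The interior `Ω° = Ω ∖ ∂Ω` of a finite vertex set `Ω`. -/
def finInterior {V : Type*} (ω : V → V → ℝ) (Ω : Finset V) : Set V :=
  {x | x ∈ Ω ∧ ∀ y, 0 < ω x y → y ∈ Ω}

/-- `Ω` is connected as a subgraph. -/
def FinsetConnected {V : Type*} (ω : V → V → ℝ) (Ω : Finset V) : Prop :=
  ∀ x ∈ Ω, ∀ y ∈ Ω, Relation.ReflTransGen (fun a b => a ∈ Ω ∧ b ∈ Ω ∧ 0 < ω a b) x y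

/-- The smallest eigenvalue `λ₁(Ω)` of the Dirichlet eigenvalue problem
`-Δ_Ω φ = λ φ` on `Ω°`, `φ = 0` on `∂Ω` (eigenfunctions are extended by zero
outside `Ω°`, so that `Δ_Ω` agrees with the graph Laplacian on `Ω°`). -/
def lambdaOne {V : Type*} (ω : V → V → ℝ) (μ : V → ℝ) (Ω : Finset V) : ℝ :=
  sInf {l : ℝ | ∃ φ : V → ℝ, φ ≠ 0 ∧ (∀ x, x ∉ finInterior ω Ω → φ x = 0) ∧
    ∀ x ∈ finInterior ω Ω, -graphLap ω μ φ x = l * φ x}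

/-- The eigenvalue condition (EC) relative to the vertex `xt`: for all `ε, δ > 0`
there is a finite connected subset `Ω ⊆ V` with nonempty interior such that
`λ₁(Ω) < ε` and `d(x, xt) > δ` for all `x ∈ Ω`. -/
def EigenCond {V : Type*} (ω : V → V → ℝ) (μ : V → ℝ) (xt : V) : Prop :=
  ∀ ε > (0:ℝ), ∀ δ : ℝ, 0 < δ → ∃ Ω : Finset V, FinsetConnected ω Ω ∧
    (finInterior ω Ω).Nonempty ∧ lambdaOne ω μ Ω < ε ∧
    ∀ x ∈ Ω, δ < (graphDist ω xt x : ℝ)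

lemma graphLap_eq_sum {V : Type*} {ω : V → V → ℝ} {μ : V → ℝ} (hnn : ∀ x y, 0 ≤ ω x y)
    {Ω : Finset V} {x : V} (hx : x ∈ finInterior ω Ω) (u : V → ℝ) :
    graphLap ω μ u x = (1 / μ x) * ∑ y ∈ Ω, ω x y * (u y - u x) := by
  unfold graphLap
  rw [tsum_eq_sum]
  intro y hy
  have h0 : ω x y = 0 := le_antisymm (not_lt.1 fun h => hy (hx.2 y h)) (hnn x y)
  simp [h0]

lemma mul_graphLap_eq_sum {V : Type*} {ω : V → V → ℝ} {μ : V → ℝ} (hG : IsWeightedGraph ω μ)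
    {Ω : Finset V} {x : V} (hx : x ∈ finInterior ω Ω) (u : V → ℝ) :
    μ x * graphLap ω μ u x = ∑ y ∈ Ω, ω x y * (u y - u x) := by
  rw [graphLap_eq_sum hG.nonneg hx, ← mul_assoc, mul_one_div_cancel (hG.measurePos x).ne', one_mul]

/-- The Dirichlet eigenvalue problem on a finite set with nonempty interior has an eigenvalue. -/
lemma exists_dirichlet_eigenvalue {V : Type*} {ω : V → V → ℝ} {μ : V → ℝ}
    (hG : IsWeightedGraph ω μ) {Ω : Finset V} (hne : (finInterior ω Ω).Nonempty) :
    ∃ l : ℝ, ∃ φ : V → ℝ, φ ≠ 0 ∧ (∀ x, x ∉ finInterior ω Ω → φ x = 0) ∧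
      ∀ x ∈ finInterior ω Ω, -graphLap ω μ φ x = l * φ x := by
  set I : Finset V := Ω.filter (· ∈ finInterior ω Ω) with hI
  have memI : ∀ x, x ∈ I ↔ x ∈ finInterior ω Ω := fun x => by
    simp only [hI, Finset.mem_filter, and_iff_right_iff_imp]; exact fun h => h.1
  have hs : ∀ x, 0 < √(μ x) := fun x => Real.sqrt_pos.2 (hG.measurePos x)
  set A : Matrix I I ℝ := fun i j =>
    ((if i = j then ∑ y ∈ Ω, ω i y else 0) - ω i j) / (√(μ i) * √(μ j)) with hA
  have hH : A.IsHermitian := by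
    refine Matrix.IsHermitian.ext fun i j => ?_
    by_cases hij : i = j
    · subst hij; simp
    · simp [hA, hij, Ne.symm hij, hG.symm j i, mul_comm]
  obtain ⟨x₀, hx₀⟩ := hne
  set i₀ : I := ⟨x₀, (memI x₀).2 hx₀⟩
  set l := hH.eigenvalues i₀
  set g : I → ℝ := ⇑(hH.eigenvectorBasis i₀)
  have hgA : A.mulVec g = l • g := hH.mulVec_eigenvectorBasis i₀
  have hg0 : g ≠ 0 := by
    intro h
    apply hH.eigenvectorBasis.orthonormal.ne_zero i₀
    ext i
    exact congrFun h i
  set φ : V → ℝ := fun x => if h : x ∈ I then g ⟨x, h⟩ / √(μ x) else 0 with hφ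
  have φI : ∀ i : I, φ i = g i / √(μ i) := fun i => by simp [hφ]
  have φ0 : ∀ x, x ∉ I → φ x = 0 := fun x hx => by simp [hφ, hx]
  refine ⟨l, φ, ?_, fun x hx => φ0 x fun h => hx ((memI x).1 h), ?_⟩
  · obtain ⟨i, hi⟩ := Function.ne_iff.1 hg0
    intro h
    have := congrFun h i
    rw [φI] at this
    exact (div_ne_zero hi (hs i).ne') this
  · intro x hx
    have hxI := (memI x).2 hx
    set i : I := ⟨x, hxI⟩
    have h1 : ∑ j : I, A i j * g j = l * g i := by
      simpa [Matrix.mulVec, dotProduct] using congrFun hgA i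
    have h2 : ∑ y ∈ Ω, ω x y * φ y = ∑ j : I, ω x j * φ j := by
      rw [Finset.sum_coe_sort I (fun y => ω x y * φ y)]
      refine (Finset.sum_subset (Finset.filter_subset _ _) fun y _ hy => ?_).symm
      rw [φ0 y hy, mul_zero]
    have h3 : ∑ j : I, A i j * g j =
        ((∑ y ∈ Ω, ω x y) * φ x - ∑ j : I, ω x j * φ j) / √(μ x) := by
      have e : ∀ j : I, A i j * g j =
          ((if i = j then (∑ y ∈ Ω, ω x y) * φ j else 0) - ω x j * φ j) / √(μ x) := by
        intro j
        have := (hs j).ne'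
        have := (hs x).ne'
        rw [φI]
        simp only [hA, i]
        split_ifs <;> (field_simp; try ring)
      rw [Finset.sum_congr rfl fun j _ => e j, ← Finset.sum_div, Finset.sum_sub_distrib,
        Finset.sum_ite_eq]
      simp [i]
    have h4 : φ x = g i / √(μ x) := φI i
    rw [graphLap_eq_sum hG.nonneg hx]
    simp only [mul_sub, Finset.sum_sub_distrib, ← Finset.sum_mul]
    rw [h2]
    rw [h3] at h1
    have hμ : μ x = √(μ x) * √(μ x) := (Real.mul_self_sqrt (hG.measurePos x).le).symm
    have hsx := (hs x).ne'
    have h5 : (∑ y ∈ Ω, ω x y) * φ x - ∑ j : I, ω x j * φ j = l * g i * √(μ x) := by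
      rw [← h1]; field_simp
    have h6 : l * φ x = l * g i * √(μ x) / μ x := by
      rw [h4, hμ, Real.sqrt_mul_self (hs x).le]; field_simp
    rw [h6, ← h5]; ring

/-- If `λ₁(Ω) < ε`, there is a normalized nonnegative function supported in the interior
of `Ω` with `Δv ≥ -εv`. -/
lemma exists_nonneg_test_function {V : Type*} {ω : V → V → ℝ} {μ : V → ℝ}
    (hG : IsWeightedGraph ω μ) {Ω : Finset V} (hne : (finInterior ω Ω).Nonempty) {ε : ℝ}
    (hl : lambdaOne ω μ Ω < ε) :
    ∃ v : V → ℝ, (∀ x, 0 ≤ v x) ∧ (∀ x, x ∉ finInterior ω Ω → v x = 0) ∧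
      ∑ x ∈ Ω, μ x * v x = 1 ∧
      ∀ x ∈ Ω, -ε * (μ x * v x) ≤ ∑ y ∈ Ω, ω x y * (v y - v x) := by
  obtain ⟨l, ⟨φ, hφ, hφ0, hφe⟩, hlε⟩ :=
    exists_lt_of_csInf_lt (exists_dirichlet_eigenvalue hG hne) hl
  set N := ∑ x ∈ Ω, μ x * |φ x|
  have hterm : ∀ x ∈ Ω, 0 ≤ μ x * |φ x| := fun x _ =>
    mul_nonneg (hG.measurePos x).le (abs_nonneg _)
  have hNpos : 0 < N := by
    obtain ⟨z, hz⟩ := Function.ne_iff.1 hφ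
    have hzI : z ∈ finInterior ω Ω := by
      by_contra h; exact hz (hφ0 z h)
    exact Finset.sum_pos' hterm ⟨z, hzI.1, mul_pos (hG.measurePos z) (abs_pos.2 hz)⟩
  have key : ∀ x ∈ Ω, -ε * (μ x * |φ x|) ≤ ∑ y ∈ Ω, ω x y * (|φ y| - |φ x|) := by
    intro x hx
    by_cases hxI : x ∈ finInterior ω Ω
    · have h1 : ∑ y ∈ Ω, ω x y * (φ y - φ x) = -l * (μ x * φ x) := by
        rw [← mul_graphLap_eq_sum hG hxI, ← neg_neg (graphLap ω μ φ x), hφe x hxI]; ring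
      have h2 : -l * (μ x * |φ x|) ≤ ∑ y ∈ Ω, ω x y * (|φ y| - |φ x|) := by
        rcases le_total 0 (φ x) with h | h
        · rw [abs_of_nonneg h, ← h1]
          exact Finset.sum_le_sum fun y _ => mul_le_mul_of_nonneg_left
            (by linarith [le_abs_self (φ y)]) (hG.nonneg x y)
        · have h3 : -l * (μ x * |φ x|) = ∑ y ∈ Ω, ω x y * (-φ y - -φ x) := by
            rw [abs_of_nonpos h, show -l * (μ x * -φ x) = -(-l * (μ x * φ x)) by ring, ← h1,
              ← Finset.sum_neg_distrib]
            exact Finset.sum_congr rfl fun y _ => by ring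
          rw [h3, abs_of_nonpos h]
          exact Finset.sum_le_sum fun y _ => mul_le_mul_of_nonneg_left
            (by linarith [neg_abs_le (φ y)]) (hG.nonneg x y)
      nlinarith [hterm x hx]
    · rw [hφ0 x hxI]
      simp only [abs_zero, mul_zero, sub_zero]
      exact Finset.sum_nonneg fun y _ => mul_nonneg (hG.nonneg x y) (abs_nonneg _)
  refine ⟨fun x => |φ x| / N, fun x => by positivity, fun x hx => by simp [hφ0 x hx], ?_, ?_⟩
  · simp only [← mul_div_assoc, ← Finset.sum_div]
    exact div_self hNpos.ne'
  · intro x hx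
    have h := div_le_div_of_nonneg_right (key x hx) hNpos.le
    simp only [← sub_div, ← mul_div_assoc, ← Finset.sum_div] at h ⊢
    exact h

/-- Green's formula on a finite set. -/
lemma sum_mul_sum_sub_comm {V : Type*} {ω : V → V → ℝ} (hsymm : ∀ x y, ω x y = ω y x)
    (Ω : Finset V) (u v : V → ℝ) :
    ∑ x ∈ Ω, v x * ∑ y ∈ Ω, ω x y * (u y - u x) =
      ∑ x ∈ Ω, u x * ∑ y ∈ Ω, ω x y * (v y - v x) := by
  have h : ∀ f g : V → ℝ, ∑ x ∈ Ω, g x * ∑ y ∈ Ω, ω x y * (f y - f x) =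
      ∑ x ∈ Ω, ∑ y ∈ Ω, ω x y * (g x * f y) - ∑ x ∈ Ω, ∑ y ∈ Ω, ω x y * (g x * f x) := by
    intro f g
    simp only [← Finset.sum_sub_distrib, Finset.mul_sum]
    exact Finset.sum_congr rfl fun x _ => Finset.sum_congr rfl fun y _ => by ring
  rw [h, h, Finset.sum_comm]
  congr 1
  · exact Finset.sum_congr rfl fun x _ => Finset.sum_congr rfl fun y _ => by
      rw [hsymm]; ring
  · exact Finset.sum_congr rfl fun x _ => Finset.sum_congr rfl fun y _ => by ring

/-- A function with `J' ≥ J ^ p - εJ` and `J 0 ≥ a > 0` can only exist for a bounded time. -/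
lemma existence_time_le {p a ε T : ℝ} (hp : 1 < p) (ha : 0 < a) (hε : 0 < ε) (hT : 0 < T)
    {J J' : ℝ → ℝ} (hJ0 : a ≤ J 0) (hJnn : ∀ t ∈ Ico 0 T, 0 ≤ J t)
    (hJc : ContinuousOn J (Ico 0 T)) (hJd : ∀ t ∈ Ioo 0 T, HasDerivAt J (J' t) t)
    (hJ' : ∀ t ∈ Ioo 0 T, -ε * J t + J t ^ p ≤ J' t) :
    T ≤ a ^ (1 - p) * Real.exp ((p - 1) * ε * T) / (p - 1) := by
  have hp1 : 0 < p - 1 := by linarith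
  set c := Real.exp (-((p - 1) * ε * T)) with hc
  set w : ℝ → ℝ := fun t => Real.exp (ε * t) * J t with hw
  have hwc : ContinuousOn w (Ico 0 T) :=
    ContinuousOn.mul (Continuous.continuousOn (by fun_prop)) hJc
  have hwd : ∀ t ∈ Ioo 0 T,
      HasDerivAt w (Real.exp (ε * t) * ε * J t + Real.exp (ε * t) * J' t) t := by
    intro t ht
    have h1 : HasDerivAt (fun t : ℝ => Real.exp (ε * t)) (Real.exp (ε * t) * ε) t := by
      simpa using ((hasDerivAt_id t).const_mul ε).exp
    exact h1.mul (hJd t ht)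
  have hwd' : ∀ t ∈ Ioo 0 T,
      c * w t ^ p ≤ Real.exp (ε * t) * ε * J t + Real.exp (ε * t) * J' t := by
    intro t ht
    have hJt := hJnn t ⟨ht.1.le, ht.2⟩
    have h1 : w t ^ p = Real.exp (ε * t * p) * J t ^ p := by
      rw [hw, Real.mul_rpow (Real.exp_pos _).le hJt, ← Real.exp_mul]
    have h2 : c * Real.exp (ε * t * p) ≤ Real.exp (ε * t) := by
      rw [hc, ← Real.exp_add]
      apply Real.exp_le_exp.2
      have : (p - 1) * ε * t ≤ (p - 1) * ε * T :=
        mul_le_mul_of_nonneg_left ht.2.le (by positivity)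
      linarith
    have h3 : 0 ≤ J t ^ p := Real.rpow_nonneg hJt p
    calc c * w t ^ p = c * Real.exp (ε * t * p) * J t ^ p := by rw [h1]; ring
      _ ≤ Real.exp (ε * t) * J t ^ p := mul_le_mul_of_nonneg_right h2 h3
      _ ≤ Real.exp (ε * t) * (ε * J t + J' t) :=
        mul_le_mul_of_nonneg_left (by linarith [hJ' t ht]) (Real.exp_pos _).le
      _ = _ := by ring
  have hwnn : ∀ t ∈ Ico 0 T, 0 ≤ w t := fun t ht =>
    mul_nonneg (Real.exp_pos _).le (hJnn t ht)
  have hmono : MonotoneOn w (Ico 0 T) := by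
    refine monotoneOn_of_deriv_nonneg (convex_Ico 0 T) hwc ?_ ?_ <;> rw [interior_Ico]
    · exact fun t ht => (hwd t ht).differentiableAt.differentiableWithinAt
    · intro t ht
      rw [(hwd t ht).deriv]
      exact le_trans (mul_nonneg (Real.exp_pos _).le
        (Real.rpow_nonneg (hwnn t ⟨ht.1.le, ht.2⟩) p)) (hwd' t ht)
  have h0 : (0 : ℝ) ∈ Ico 0 T := ⟨le_rfl, hT⟩
  have hw0 : a ≤ w 0 := by simpa [hw] using hJ0
  have hwpos : ∀ t ∈ Ico 0 T, 0 < w t := fun t ht =>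
    ha.trans_le (hw0.trans (hmono h0 ht ht.1))
  have hKd : ∀ t ∈ Ioo 0 T, HasDerivAt (fun t => w t ^ (1 - p) + (p - 1) * c * t)
      ((Real.exp (ε * t) * ε * J t + Real.exp (ε * t) * J' t) * (1 - p) * w t ^ (1 - p - 1)
        + (p - 1) * c) t := by
    intro t ht
    have h1 := (hwd t ht).rpow_const (p := 1 - p) (Or.inl (hwpos t ⟨ht.1.le, ht.2⟩).ne')
    have h2 : HasDerivAt (fun t : ℝ => (p - 1) * c * t) ((p - 1) * c) t := by
      simpa using (hasDerivAt_id t).const_mul ((p - 1) * c)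
    exact h1.add h2
  have hanti : AntitoneOn (fun t => w t ^ (1 - p) + (p - 1) * c * t) (Ico 0 T) := by
    refine antitoneOn_of_deriv_nonpos (convex_Ico 0 T) ?_ ?_ ?_
    · exact (hwc.rpow_const fun t ht => Or.inl (hwpos t ht).ne').add
        (Continuous.continuousOn (by fun_prop))
    all_goals rw [interior_Ico]
    · exact fun t ht => (hKd t ht).differentiableAt.differentiableWithinAt
    · intro t ht
      rw [(hKd t ht).deriv]
      have hpos := hwpos t ⟨ht.1.le, ht.2⟩
      have h1 : w t ^ p * w t ^ (1 - p - 1) = 1 := by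
        rw [← Real.rpow_add hpos]; simp
      have h2 := mul_le_mul_of_nonneg_right (hwd' t ht)
        (Real.rpow_nonneg hpos.le (1 - p - 1))
      rw [mul_assoc, h1, mul_one] at h2
      have h3 := mul_le_mul_of_nonneg_left h2 hp1.le
      linarith
  have hbound : ∀ t ∈ Ico 0 T, t ≤ a ^ (1 - p) * Real.exp ((p - 1) * ε * T) / (p - 1) := by
    intro t ht
    have h1 := hanti h0 ht ht.1
    simp only [mul_zero, add_zero] at h1
    have h2 : w 0 ^ (1 - p) ≤ a ^ (1 - p) :=
      Real.rpow_le_rpow_of_nonpos ha hw0 (by linarith)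
    have h3 := Real.rpow_nonneg (hwnn t ht) (1 - p)
    have h4 : (p - 1) * c * t ≤ a ^ (1 - p) := by linarith
    have h5 : Real.exp ((p - 1) * ε * T) * c = 1 := by
      rw [hc, ← Real.exp_add]; simp
    have h6 := mul_le_mul_of_nonneg_right h4 (Real.exp_pos ((p - 1) * ε * T)).le
    rw [le_div_iff₀ hp1]
    calc t * (p - 1) = (p - 1) * c * t * Real.exp ((p - 1) * ε * T) := by
          linear_combination (-(t * (p - 1))) * h5
      _ ≤ _ := h6
  by_contra! hlt
  obtain ⟨t, ht1, ht2⟩ := exists_between (max_lt hlt hT)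
  exact absurd (hbound t ⟨(le_max_right _ _).trans ht1.le, ht2⟩)
    (not_le.2 ((le_max_left _ _).trans_lt ht1))

/-- A solution whose initial datum is at least `a > 0` on a finite set `Ω` with
`λ₁(Ω) < ε` exists only for a bounded time. -/
lemma IsHeatSol.time_le_s2 {V : Type*} {ω : V → V → ℝ} {μ : V → ℝ} (hG : IsWeightedGraph ω μ)
    {p : ℝ} (hp : 1 < p) {ψ0 : V → ℝ} {T : ℝ} (hT : 0 < T) {u : V → ℝ → ℝ}
    (hu : IsHeatSol (graphLap ω μ) p ψ0 T u) {Ω : Finset V}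
    (hne : (finInterior ω Ω).Nonempty) {ε a : ℝ} (hε : 0 < ε) (ha : 0 < a)
    (hl : lambdaOne ω μ Ω < ε) (hψ : ∀ x ∈ Ω, a ≤ ψ0 x) :
    T ≤ a ^ (1 - p) * Real.exp ((p - 1) * ε * T) / (p - 1) := by
  obtain ⟨v, hv, hv0, hv1, hvL⟩ := exists_nonneg_test_function hG hne hl
  have hw : ∀ x ∈ Ω, 0 ≤ μ x * v x := fun x _ => mul_nonneg (hG.measurePos x).le (hv x)
  refine existence_time_le hp ha hε hT (J := fun t => ∑ x ∈ Ω, μ x * v x * u x t)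
    (J' := fun t => ∑ x ∈ Ω, μ x * v x * (graphLap ω μ (fun y => u y t) x + u x t ^ p))
    ?_ ?_ ?_ ?_ ?_
  · calc a = ∑ x ∈ Ω, μ x * v x * a := by rw [← Finset.sum_mul, hv1, one_mul]
      _ ≤ _ := Finset.sum_le_sum fun x hx => mul_le_mul_of_nonneg_left
        (by rw [hu.init]; exact hψ x hx) (hw x hx)
  · exact fun t ht => Finset.sum_nonneg fun x hx => mul_nonneg (hw x hx) (hu.nonneg x t ht)
  · exact continuousOn_finsetSum _ fun x _ => continuousOn_const.mul (hu.cont x)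
  · exact fun t ht => HasDerivAt.fun_sum fun x _ => (hu.eqn x t ht).const_mul _
  · intro t ht
    have hunn : ∀ x, 0 ≤ u x t := fun x => hu.nonneg x t ⟨ht.1.le, ht.2⟩
    have hjensen := Real.rpow_arith_mean_le_arith_mean_rpow Ω (fun x => μ x * v x)
      (fun x => u x t) hw hv1 (fun x _ => hunn x) hp.le
    have hgreen : -ε * ∑ x ∈ Ω, μ x * v x * u x t ≤
        ∑ x ∈ Ω, μ x * v x * graphLap ω μ (fun y => u y t) x := by
      calc -ε * ∑ x ∈ Ω, μ x * v x * u x t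
          = ∑ x ∈ Ω, u x t * (-ε * (μ x * v x)) := by
            rw [Finset.mul_sum]; exact Finset.sum_congr rfl fun x _ => by ring
        _ ≤ ∑ x ∈ Ω, u x t * ∑ y ∈ Ω, ω x y * (v y - v x) :=
            Finset.sum_le_sum fun x hx => mul_le_mul_of_nonneg_left (hvL x hx) (hunn x)
        _ = ∑ x ∈ Ω, v x * ∑ y ∈ Ω, ω x y * (u y t - u x t) :=
            (sum_mul_sum_sub_comm hG.symm Ω (fun x => u x t) v).symm
        _ = _ := by
            refine Finset.sum_congr rfl fun x _ => ?_
            by_cases hx : x ∈ finInterior ω Ω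
            · rw [← mul_graphLap_eq_sum hG hx (fun y => u y t)]; ring
            · simp [hv0 x hx]
    simp only [mul_add, Finset.sum_add_distrib]
    exact add_le_add hgreen hjensen

/-- Theorem 1.5(1): under `D_μ < ∞`, if `ψ(x) → ψ_∞ > 0` as `d(x̃,x) → ∞` and
the eigenvalue condition (EC) holds, then for every `λ > 0` the life span
satisfies `T_λ ≤ 1/((p-1) λ^{p-1} ψ_∞^{p-1})`. -/
theorem stmt2 {V : Type*} [Infinite V] [Countable V]
    (ω : V → V → ℝ) (μ : V → ℝ) (hG : IsWeightedGraph ω μ) (hD : DmuFinite ω μ)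
    (p : ℝ) (hp : 1 < p)
    (ψ : V → ℝ) (hψ0 : ∀ x, 0 ≤ ψ x) (hψbd : ∃ C : ℝ, ∀ x, ψ x ≤ C)
    (hψne : ∃ x, ψ x ≠ 0)
    (xt : V) (psiInf : ℝ) (hpsiInf : 0 < psiInf)
    (hlim : ∀ ε > (0:ℝ), ∃ R : ℕ, ∀ x, R ≤ graphDist ω xt x → |ψ x - psiInf| < ε)
    (hEC : EigenCond ω μ xt) :
    ∀ lam : ℝ, 0 < lam →
      lifeSpan (graphLap ω μ) p (fun x => lam * ψ x) ≤
        ENNReal.ofReal (1 / ((p - 1) * lam ^ (p - 1) * psiInf ^ (p - 1))) := by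
  intro lam hlam
  refine iSup₂_le fun T ⟨hT, u, hu⟩ => ENNReal.ofReal_le_ofReal ?_
  have hbound : ∀ η ∈ Ioo 0 psiInf,
      T ≤ (lam * (psiInf - η)) ^ (1 - p) * Real.exp ((p - 1) * η * T) / (p - 1) := by
    intro η hη
    obtain ⟨R, hR⟩ := hlim η hη.1
    obtain ⟨Ω, -, hne, hl, hfar⟩ := hEC η hη.1 (R + 1) (by positivity)
    refine hu.time_le_s2 hG hp hT hne hη.1 (mul_pos hlam (sub_pos.2 hη.2)) hl fun x hx => ?_
    have hRx : R ≤ graphDist ω xt x := by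
      have : (R : ℝ) ≤ graphDist ω xt x := by linarith [hfar x hx]
      exact_mod_cast this
    have := (abs_lt.1 (hR x hRx)).1
    exact mul_le_mul_of_nonneg_left (by linarith) hlam.le
  have hlimit : Tendsto
      (fun η => (lam * (psiInf - η)) ^ (1 - p) * Real.exp ((p - 1) * η * T) / (p - 1))
      (𝓝[>] 0) (𝓝 ((lam * (psiInf - 0)) ^ (1 - p) * Real.exp ((p - 1) * 0 * T) / (p - 1))) := by
    refine Tendsto.mono_left (ContinuousAt.tendsto ?_) nhdsWithin_le_nhds
    refine ((ContinuousAt.rpow_const (by fun_prop) (Or.inl ?_)).mul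
      (by fun_prop)).div_const _
    simp [hlam.ne', hpsiInf.ne']
  have hle := ge_of_tendsto hlimit
    (Filter.mem_of_superset (Ioo_mem_nhdsGT hpsiInf) hbound)
  refine hle.trans_eq ?_
  have h1 : (lam * psiInf) ^ (1 - p) = (lam ^ (p - 1) * psiInf ^ (p - 1))⁻¹ := by
    rw [← Real.mul_rpow hlam.le hpsiInf.le, ← Real.rpow_neg (by positivity), neg_sub]
  rw [sub_zero, h1]
  simp only [mul_zero, zero_mul, Real.exp_zero, mul_one]
  rw [mul_assoc, one_div, mul_inv (p - 1), div_eq_mul_inv, mul_comm]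
end
end
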